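/- Let V be a finite-dimensional real inner product space, ν > 0, and B : V × V × V → ℝ a map such that v ↦ B(κ; u, v) is linear for each κ, u, such that B(v; v, v) ≥ ν‖v‖² for all v ∈ V, and such that (κ,u) ↦ B(κ;u,v) is continuous for each fixed v. Then for every linear functional F : V → ℝ there exists u ∈ V with B(u; u, v) = F(v) for all v ∈ V; moreover any such u satisfies ν‖u‖ ≤ ‖F‖. -/

import Mathlib

open Polynomial in
theorem aux_lagrange (V : Type*) [NormedAddCommGroup V] [InnerProductSpace ℝ V]
    [FiniteDimensional ℝ V] (ε : ℝ) (hε : 0 < ε) :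
    ∃ (s : Finset ℕ) (c τ : ℕ → ℝ), (∀ i, 0 < τ i ∧ τ i < ε) ∧ ∑ i ∈ s, c i = 1 ∧
      ∀ A : V →L[ℝ] V, (ContinuousLinearMap.id ℝ V + A).det =
        ∑ i ∈ s, c i * (ContinuousLinearMap.id ℝ V + τ i • A).det := by
  set n := Module.finrank ℝ V with hn
  set s := Finset.range (n + 1)
  set τ : ℕ → ℝ := fun i => ε / (i + 2) with hτ
  have hinj : Set.InjOn τ s := by
    intro i _ j _ h
    simp only [hτ] at h
    rw [div_eq_div_iff (by positivity) (by positivity)] at h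
    have := mul_left_cancel₀ hε.ne' h
    have : (i : ℝ) = j := by linarith
    exact_mod_cast this
  have key : ∀ p : ℝ[X], p.natDegree ≤ n →
      p.eval 1 = ∑ i ∈ s, (Lagrange.basis s τ i).eval 1 * p.eval (τ i) := by
    intro p hp
    have hd : p.degree < s.card := by
      refine lt_of_le_of_lt Polynomial.degree_le_natDegree ?_
      simp only [s, Finset.card_range]
      exact_mod_cast Nat.lt_succ_of_le hp
    conv_lhs => rw [Lagrange.eq_interpolate hinj hd]
    simp [Lagrange.interpolate_apply, eval_finsetSum, mul_comm]
  refine ⟨s, fun i => (Lagrange.basis s τ i).eval 1, τ, ?_, ?_, ?_⟩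
  · intro i
    refine ⟨by positivity, ?_⟩
    rw [hτ]
    apply div_lt_self hε
    have : (0 : ℝ) ≤ i := by positivity
    linarith
  · have := key 1 (by simp)
    simpa using this.symm
  · intro A
    let b := Module.finBasis ℝ V
    let M := LinearMap.toMatrix b b (A : V →ₗ[ℝ] V)
    let p : ℝ[X] := ((X : ℝ[X]) • M.map C + (1 : Matrix _ _ ℝ).map C).det
    have hdet : ∀ t : ℝ, (ContinuousLinearMap.id ℝ V + t • A).det = p.eval t := by
      intro t
      have h1 : p.eval t = (t • M + 1).det := by
        simp only [p]
        rw [← Polynomial.coe_evalRingHom, RingHom.map_det]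
        congr 1
        ext i j
        by_cases hij : i = j <;> (simp [hij]; ring)
      rw [h1, ContinuousLinearMap.det, ← LinearMap.det_toMatrix b]
      congr 1
      simp [M, add_comm]
    have := key p ((Polynomial.natDegree_det_X_add_C_le M 1).trans (by simp [hn]) )
    rw [← hdet] at this
    simp only [← hdet, one_smul] at this
    exact this

theorem aux_glue {V : Type*} [NormedAddCommGroup V] [InnerProductSpace ℝ V]
    (ρ : ℝ) (q : V → V) (C : NNReal)
    (hq : LipschitzOnWith C q (Metric.closedBall 0 ρ)) (h0 : ∀ x, ‖x‖ = ρ → q x = 0)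
    (g : V → V) (hg1 : ∀ x, ‖x‖ ≤ ρ → g x = q x) (hg2 : ∀ x, ρ ≤ ‖x‖ → g x = 0) :
    LipschitzWith C g := by
  have main : ∀ x y, ‖x‖ ≤ ρ → ρ ≤ ‖y‖ → dist (g x) (g y) ≤ C * dist x y := by
    intro x y hx hy
    have hc : ContinuousOn (fun t : ℝ => ‖x + t • (y - x)‖) (Set.Icc 0 1) := by fun_prop
    have := intermediate_value_Icc (zero_le_one' ℝ) hc
    obtain ⟨t, ht, hz⟩ := this (show ρ ∈ _ by simpa using ⟨hx, hy⟩)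
    simp only at hz
    set z := x + t • (y - x) with hzd
    have h1 : dist (q x) (q z) ≤ C * dist x z :=
      hq.dist_le_mul x (by simpa using hx) z (by simpa using hz.le)
    have h2 : dist x z ≤ dist x y := by
      rw [dist_eq_norm, dist_eq_norm, hzd, sub_add_cancel_left, norm_neg, norm_smul,
        Real.norm_of_nonneg ht.1, norm_sub_rev y x]
      exact mul_le_of_le_one_left (norm_nonneg _) ht.2
    rw [hg1 x hx, hg2 y hy, ← h0 z hz]
    exact h1.trans (by gcongr)
  refine LipschitzWith.of_dist_le_mul fun x y => ?_
  rcases le_total ‖x‖ ρ with hx | hx <;> rcases le_total ‖y‖ ρ with hy | hy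
  · rw [hg1 x hx, hg1 y hy]
    exact hq.dist_le_mul x (by simpa using hx) y (by simpa using hy)
  · exact main x y hx hy
  · rw [dist_comm, dist_comm x]; exact main y x hy hx
  · rw [hg2 x hx, hg2 y hy, dist_self]; positivity

open MeasureTheory in
theorem aux_volume {V : Type*} [NormedAddCommGroup V] [InnerProductSpace ℝ V]
    [FiniteDimensional ℝ V] [MeasurableSpace V] [BorelSpace V] (ρ : ℝ) (g : V → V) (C : NNReal)
    (hg : LipschitzWith C g) (h0 : ∀ x, ρ ≤ ‖x‖ → g x = 0)
    (hd : ∀ x, ‖x‖ < ρ → DifferentiableAt ℝ g x) :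
    ∫ x in Metric.ball (0 : V) ρ, (ContinuousLinearMap.id ℝ V + fderiv ℝ g x).det =
      (volume (Metric.ball (0 : V) ρ)).toReal := by
  obtain ⟨δ, hδ, hpos⟩ : ∃ δ > 0, ∀ L : V →L[ℝ] V, dist L (ContinuousLinearMap.id ℝ V) < δ →
      0 < L.det := by
    have h := (ContinuousLinearMap.continuous_det (𝕜 := ℝ) (E := V)).continuousAt
      (x := ContinuousLinearMap.id ℝ V)
    have h1 : (0 : ℝ) < (ContinuousLinearMap.id ℝ V).det := by
      simp [ContinuousLinearMap.det]
    have := h.tendsto.eventually (lt_mem_nhds h1)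
    exact Metric.eventually_nhds_iff.1 this
  have hfd : ∀ x, ‖fderiv ℝ g x‖ ≤ C := fun x => norm_fderiv_le_of_lipschitz ℝ hg
  set ε := min δ 1 / (C + 1) with hε
  have hεpos : 0 < ε := by positivity
  have hC0 : (0 : ℝ) ≤ C := C.2
  obtain ⟨s, c, τ, hτ, hc, hA⟩ := aux_lagrange V ε hεpos
  have hτC : ∀ i, τ i * C < min δ 1 := by
    intro i
    have h1 := (hτ i).2
    rw [hε, lt_div_iff₀ (by positivity)] at h1
    nlinarith [(hτ i).1]
  have hmeas : ∀ t : ℝ, Measurable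
      fun x => (ContinuousLinearMap.id ℝ V + t • fderiv ℝ g x).det := by
    intro t
    apply ContinuousLinearMap.continuous_det.measurable.comp
    exact ((measurable_fderiv ℝ g).const_smul t).const_add _
  have hint : ∀ t : ℝ, IntegrableOn
      (fun x => (ContinuousLinearMap.id ℝ V + t • fderiv ℝ g x).det) (Metric.ball 0 ρ) := by
    intro t
    obtain ⟨B, hB⟩ := (isCompact_closedBall (0 : V →L[ℝ] V) C).exists_bound_of_continuousOn
      (f := fun A => (ContinuousLinearMap.id ℝ V + t • A).det)
      (ContinuousLinearMap.continuous_det.comp (by fun_prop)).continuousOn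
    refine Measure.integrableOn_of_bounded (M := B) measure_ball_lt_top.ne
      (hmeas t).aestronglyMeasurable ?_
    exact Filter.Eventually.of_forall fun x => hB _ (by simpa using hfd x)
  have hvol : ∀ i, ∫ x in Metric.ball (0 : V) ρ,
      (ContinuousLinearMap.id ℝ V + τ i • fderiv ℝ g x).det =
      (volume (Metric.ball (0 : V) ρ)).toReal := by
    intro i
    set t := τ i
    have ht : 0 < t := (hτ i).1
    set f : V → V := fun x => x + t • g x with hf
    have happ : ApproximatesLinearOn f ((ContinuousLinearEquiv.refl ℝ V : V ≃L[ℝ] V) : V →L[ℝ] V)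
        Set.univ (Real.toNNReal t * C) := by
      intro x _ y _
      have : f x - f y - ((ContinuousLinearEquiv.refl ℝ V : V ≃L[ℝ] V) : V →L[ℝ] V) (x - y) =
        t • (g x - g y) := by
        simp [hf, smul_sub]; abel
      rw [this, norm_smul, Real.norm_of_nonneg ht.le]
      have := hg.dist_le_mul x y
      rw [dist_eq_norm, dist_eq_norm] at this
      push_cast
      rw [Real.coe_toNNReal _ ht.le, mul_assoc]
      gcongr
    have hlt : Subsingleton V ∨ Real.toNNReal t * C <
        ‖((ContinuousLinearEquiv.refl ℝ V).symm : V →L[ℝ] V)‖₊⁻¹ := by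
      rcases subsingleton_or_nontrivial V with h | h
      · exact Or.inl h
      · right
        have h1 : ‖((ContinuousLinearEquiv.refl ℝ V).symm : V →L[ℝ] V)‖₊ = 1 := by
          have : ((ContinuousLinearEquiv.refl ℝ V).symm : V →L[ℝ] V) =
            ContinuousLinearMap.id ℝ V := rfl
          rw [this]
          ext
          simp
        rw [h1, inv_one, ← NNReal.coe_lt_coe]
        push_cast
        rw [Real.coe_toNNReal _ ht.le]
        exact (hτC i).trans_le (min_le_right _ _)
    have hinj : Set.InjOn f Set.univ := happ.injOn hlt
    have hsurj : Function.Surjective f := happ.surjective hlt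
    have hout : ∀ x, ρ ≤ ‖x‖ → f x = x := fun x hx => by simp [hf, h0 x hx]
    have himg : f '' Metric.ball 0 ρ = Metric.ball 0 ρ := by
      ext y
      simp only [Set.mem_image, mem_ball_zero_iff]
      constructor
      · rintro ⟨x, hx, rfl⟩
        by_contra hy
        have := hinj (Set.mem_univ _) (Set.mem_univ _) (hout (f x) (not_lt.1 hy))
        rw [this] at hy
        exact hy hx
      · intro hy
        obtain ⟨x, rfl⟩ := hsurj y
        refine ⟨x, ?_, rfl⟩
        by_contra hx
        rw [hout x (not_lt.1 hx)] at hy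
        exact hx hy
    have hcv := integral_image_eq_integral_abs_det_fderiv_smul (volume : Measure V)
      (s := Metric.ball 0 ρ) (f := f)
      (f' := fun x => ContinuousLinearMap.id ℝ V + t • fderiv ℝ g x)
      Metric.isOpen_ball.measurableSet
      (fun x hx => ((hasFDerivAt_id x).add
        ((hd x (by simpa using hx)).hasFDerivAt.const_smul t)).hasFDerivWithinAt)
      (hinj.mono (Set.subset_univ _)) (fun _ => (1 : ℝ))
    rw [himg] at hcv
    simp only [smul_eq_mul, mul_one, integral_const, MeasurableSet.univ,
      measureReal_restrict_apply, Set.univ_inter] at hcv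
    rw [← Measure.real, hcv]
    refine integral_congr_ae (Filter.Eventually.of_forall fun x => ?_)
    refine (abs_of_pos (hpos _ ?_)).symm
    rw [dist_eq_norm, add_sub_cancel_left, norm_smul, Real.norm_of_nonneg ht.le]
    calc t * ‖fderiv ℝ g x‖ ≤ t * C := by gcongr; exact hfd x
      _ < min δ 1 := hτC i
      _ ≤ δ := min_le_left _ _
  have hfun : (fun x => (ContinuousLinearMap.id ℝ V + fderiv ℝ g x).det) = fun x =>
      ∑ i ∈ s, c i * (ContinuousLinearMap.id ℝ V + τ i • fderiv ℝ g x).det :=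
    funext fun x => hA _
  rw [hfun]
  rw [integral_finsetSum _ (fun i _ => (hint (τ i)).const_mul (c i))]
  simp only [integral_const_mul, hvol]
  rw [← Finset.sum_mul, hc, one_mul]

open MeasureTheory in
/-- no `C¹` nowhere zero map on a ball which is the identity on the sphere -/
theorem aux_noretract {V : Type*} [NormedAddCommGroup V] [InnerProductSpace ℝ V]
    [FiniteDimensional ℝ V] (ρ : ℝ) (hρ : 0 < ρ) (K : V → V) (hK : ContDiff ℝ 1 K)
    (hne : ∀ x, K x ≠ 0) (hid : ∀ x, ‖x‖ = ρ → K x = x) : False := by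
  let : MeasurableSpace V := borel V
  have : BorelSpace V := ⟨rfl⟩
  set r : V → V := fun x => (ρ * ‖K x‖⁻¹) • K x with hr
  have hrC : ContDiff ℝ 1 r := by
    refine ContDiff.smul (contDiff_const.mul (ContDiff.inv (hK.norm ℝ hne) ?_)) hK
    intro x; simpa using hne x
  have hrn : ∀ x, ‖r x‖ = ρ := by
    intro x
    have : ‖K x‖ ≠ 0 := by simpa using hne x
    rw [hr]
    simp only [norm_smul, norm_mul, norm_inv, norm_norm, Real.norm_of_nonneg hρ.le]
    field_simp
  set q : V → V := fun x => r x - x with hq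
  have hqC : ContDiff ℝ 1 q := hrC.sub contDiff_id
  obtain ⟨C, hC⟩ := (hqC.contDiffOn (s := Metric.closedBall 0 ρ)).exists_lipschitzOnWith
    one_ne_zero (convex_closedBall _ _) (isCompact_closedBall _ _)
  have hq0 : ∀ x, ‖x‖ = ρ → q x = 0 := by
    intro x hx
    simp only [hq, hr, hid x hx, hx]
    rw [mul_inv_cancel₀ hρ.ne', one_smul, sub_self]
  classical
  set g : V → V := fun x => if ‖x‖ < ρ then q x else 0 with hg
  have hg1 : ∀ x, ‖x‖ < ρ → g x = q x := fun x hx => by simp [hg, hx]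
  have hg2 : ∀ x, ρ ≤ ‖x‖ → g x = 0 := fun x hx => by simp [hg, hx]
  have hgL : LipschitzWith C g := by
    refine aux_glue ρ q C hC hq0 g (fun x hx => ?_) hg2
    rcases hx.lt_or_eq with h | h
    · exact hg1 x h
    · rw [hg2 x h.ge, hq0 x h]
  have hev : ∀ x, ‖x‖ < ρ → g =ᶠ[nhds x] q := by
    intro x hx
    filter_upwards [Metric.isOpen_ball.mem_nhds (show x ∈ Metric.ball (0 : V) ρ by simpa using hx)]
      with y hy
    exact hg1 y (by simpa using hy)
  have hqd : Differentiable ℝ q := hqC.differentiable one_ne_zero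
  have hrd : Differentiable ℝ r := hrC.differentiable one_ne_zero
  have hv := aux_volume ρ g C hgL hg2 (fun x hx => (hqd x).congr_of_eventuallyEq (hev x hx))
  have hz : ∫ x in Metric.ball (0 : V) ρ, (ContinuousLinearMap.id ℝ V + fderiv ℝ g x).det = 0 := by
    rw [← integral_zero V ℝ (μ := volume.restrict (Metric.ball (0 : V) ρ))]
    refine setIntegral_congr_fun Metric.isOpen_ball.measurableSet fun x hx => ?_
    have hx' : ‖x‖ < ρ := by simpa using hx
    have e1 : ContinuousLinearMap.id ℝ V + fderiv ℝ g x = fderiv ℝ r x := by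
      rw [(hev x hx').fderiv_eq, hq, fderiv_fun_sub (hrd x) differentiableAt_fun_id]
      simp
    simp only [e1]
    by_contra hdet
    have hs : Function.Surjective (fderiv ℝ r x) := by
      have hu : IsUnit (LinearMap.det (fderiv ℝ r x : V →ₗ[ℝ] V)) := isUnit_iff_ne_zero.2 hdet
      have := (LinearMap.isUnit_iff_isUnit_det _).2 hu
      exact ((Module.End.isUnit_iff _).1 this).2
    obtain ⟨w, hw⟩ := hs (r x)
    have h1 : HasFDerivAt (fun y => ‖r y‖ ^ 2) _ x := (hrd x).hasFDerivAt.norm_sq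
    have h2 : HasFDerivAt (fun y => ‖r y‖ ^ 2) (0 : V →L[ℝ] ℝ) x := by
      simp only [hrn]; exact hasFDerivAt_const _ _
    have h3 := congrArg (fun L : V →L[ℝ] ℝ => L w) (h1.unique h2)
    simp [hw, hrn] at h3
    exact hρ.ne' h3
  rw [hz] at hv
  have := ENNReal.toReal_pos (Metric.measure_ball_pos volume (0 : V) hρ).ne'
    (measure_ball_lt_top (μ := (volume : Measure V))).ne
  linarith

open RealInnerProductSpace in
theorem aux_zero {V : Type*} [NormedAddCommGroup V] [InnerProductSpace ℝ V]
    [FiniteDimensional ℝ V] (R : ℝ) (hR : 0 < R) (G : V → V) (hG : Continuous G)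
    (hc : ∀ x, R ≤ ‖x‖ → ‖x‖ ≤ ⟪G x, x⟫) : ∃ x, G x = 0 := by
  by_contra! hne
  obtain ⟨g, hg, hgG, -⟩ := hG.exists_contDiff_approx (ε := fun x => min 1 ‖G x‖) 1 (by fun_prop)
    (fun x => lt_min one_pos (norm_pos_iff.2 (hne x)))
  let b : ContDiffBump (0 : V) := ⟨R, 2 * R, hR, by linarith⟩
  have hpos : ∀ x, R ≤ ‖x‖ → 0 < ⟪g x, x⟫ := by
    intro x hx
    have h1 := hc x hx
    have h2 : ‖g x - G x‖ < 1 := by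
      rw [← dist_eq_norm]; exact (hgG x).trans_le (min_le_left _ _)
    have h3 := neg_le_of_abs_le (abs_real_inner_le_norm (g x - G x) x)
    rw [inner_sub_left] at h3
    nlinarith
  refine aux_noretract (2 * R) (by linarith) (fun x => b x • g x + (1 - b x) • x) ?_ ?_ ?_
  · have hb : ContDiff ℝ 1 b := b.contDiff
    exact (hb.smul (by exact_mod_cast hg)).add ((contDiff_const.sub hb).smul contDiff_id)
  · intro x h
    rcases le_total ‖x‖ R with hx | hx
    · have : b x = 1 := b.one_of_mem_closedBall (by simpa [b] using hx)
      simp only [this, one_smul, sub_self, zero_smul, add_zero] at h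
      have := (hgG x).trans_le (min_le_right _ _)
      rw [h, dist_zero_left] at this
      exact lt_irrefl _ this
    · have h1 := congrArg (fun z => ⟪z, x⟫) h
      simp only [inner_add_left, real_inner_smul_left, inner_zero_left,
        real_inner_self_eq_norm_sq] at h1
      have h2 := hpos x hx
      have h3 : 0 < ‖x‖ ^ 2 := by have : 0 < ‖x‖ := by linarith
                                  positivity
      have h4 := b.nonneg (x := x)
      have h5 := b.le_one (x := x)
      rcases h4.eq_or_lt with h6 | h6
      · rw [← h6] at h1; linarith
      · nlinarith [mul_pos h6 h2, mul_nonneg (sub_nonneg.2 h5) h3.le]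
  · intro x hx
    have : b x = 0 := b.zero_of_le_dist (by simp [b, hx])
    simp [this]


/-- Abstract Brouwer-fixed-point existence argument (Girault–Raviart Thm 1.2, used in
Theorem 3.4): on a finite-dimensional inner product space, a coercive continuous
nonlinear form `B` admits a solution of `B(u;u,v) = F(v)` for every linear functional
`F`, and any solution satisfies `ν‖u‖ ≤ ‖F‖`. -/
theorem stmt10 {V : Type*} [NormedAddCommGroup V] [InnerProductSpace ℝ V]
    [FiniteDimensional ℝ V]
    (ν : ℝ) (hν : 0 < ν) (B : V → V → V → ℝ)
    (hlin : ∀ κ u, IsLinearMap ℝ (B κ u))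
    (hcoer : ∀ v : V, B v v v ≥ ν * ‖v‖ ^ 2)
    (hcont : ∀ v : V, Continuous (fun p : V × V => B p.1 p.2 v))
    (F : V →L[ℝ] ℝ) :
    (∃ u : V, ∀ v, B u u v = F v) ∧
      (∀ u : V, (∀ v, B u u v = F v) → ν * ‖u‖ ≤ ‖F‖) := by
  have hbound : ∀ v : V, F v ≤ ‖F‖ * ‖v‖ := fun v => (le_abs_self _).trans (F.le_opNorm v)
  refine ⟨?_, ?_⟩
  · let L : V → (V →L[ℝ] ℝ) := fun u =>
      LinearMap.toContinuousLinearMap (IsLinearMap.mk' (B u u) (hlin u u))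
    have hL : ∀ u v, L u v = B u u v := fun u v => rfl
    have hLc : Continuous L := by
      refine continuous_clm_apply.2 fun v => ?_
      exact (hcont v).comp (continuous_id.prodMk continuous_id)
    let G : V → V := fun u => (InnerProductSpace.toDual ℝ V).symm (L u - F)
    have hG : ∀ u v, inner ℝ (G u) v = B u u v - F v := by
      intro u v
      simp only [G, InnerProductSpace.toDual_symm_apply]
      rfl
    have hGc : Continuous G := by
      refine (InnerProductSpace.toDual ℝ V).symm.continuous.comp (hLc.sub continuous_const)
    obtain ⟨u, hu⟩ := aux_zero ((‖F‖ + 1) / ν) (by positivity) G hGc (by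
      intro x hx
      rw [hG]
      rw [div_le_iff₀ hν] at hx
      have h1 := hcoer x
      have h2 := hbound x
      nlinarith [mul_le_mul_of_nonneg_right hx (norm_nonneg x)])
    refine ⟨u, fun v => ?_⟩
    have := hG u v
    rw [hu, inner_zero_left] at this
    linarith
  · intro u hu
    have h1 := hcoer u
    rw [hu] at h1
    have h2 := hbound u
    rcases (norm_nonneg u).eq_or_lt with h | h
    · rw [← h]; simp
    · refine le_of_mul_le_mul_right ?_ h
      nlinarith
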